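/- Let 1 < p < 2, f_p(x) := |x|^p, let A be an invertible self-adjoint n × n complex matrix with spectral decomposition A = Σ_i λ_i E_i^A, and let B be a self-adjoint n × n complex matrix. Then ψ(t) := Tr(f_p(A + tB)) is twice differentiable at t = 0 and ψ''(0) = Σ_{i,j} (f_p^{[2]}(λ_i, λ_j, λ_i) + f_p^{[2]}(λ_j, λ_i, λ_j)) Tr(B E_j^A B E_i^A). -/

import Mathlib

open scoped BigOperators Matrix

/-- The sum of a Hermitian matrix and a real multiple of a Hermitian matrix is Hermitian. -/
theorem isHermitian_add_smul {k : ℕ} {A B : Matrix (Fin k) (Fin k) ℂ}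
    (hA : A.IsHermitian) (hB : B.IsHermitian) (t : ℝ) : (A + t • B).IsHermitian := by
  rw [Matrix.IsHermitian, Matrix.conjTranspose_add, Matrix.conjTranspose_smul, star_trivial,
    hA.eq, hB.eq]

/-- First divided difference: `f^{[1]}(r,s) = (f r - f s)/(r - s)` for `r ≠ s`,
and `f'(r)` for `r = s`. -/
noncomputable def dd1 (f : ℝ → ℝ) (r s : ℝ) : ℝ :=
  if r = s then deriv f r else (f r - f s) / (r - s)

/-- Second divided difference: `f^{[2]}(r,s,t) = (f^{[1]}(r,s) - f^{[1]}(r,t))/(s - t)`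
for `s ≠ t`, and `(∂/∂λ)|_{λ=s} f^{[1]}(r,λ)` for `s = t`. -/
noncomputable def dd2 (f : ℝ → ℝ) (r s t : ℝ) : ℝ :=
  if s = t then deriv (fun x => dd1 f r x) s else (dd1 f r s - dd1 f r t) / (s - t)

open Filter Topology

theorem dd1_eq_dslope (f : ℝ → ℝ) (r : ℝ) : dd1 f r = dslope f r := by
  ext s
  rcases eq_or_ne r s with rfl | h
  · simp [dd1]
  · rw [dslope_of_ne _ h.symm, dd1, if_neg h, slope_def_field, ← neg_sub (f s), ← neg_sub s,
      neg_div_neg_eq]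

theorem sub_mul_dd1 (f : ℝ → ℝ) (r s : ℝ) : (s - r) * dd1 f r s = f s - f r := by
  simpa [dd1_eq_dslope] using sub_smul_dslope f r s

theorem dd1_comm (f : ℝ → ℝ) (r s : ℝ) : dd1 f r s = dd1 f s r := by
  rcases eq_or_ne r s with rfl | h
  · rfl
  · rw [dd1, dd1, if_neg h, if_neg h.symm, ← neg_sub (f s), ← neg_sub s, neg_div_neg_eq]

theorem continuous_dd1 {f : ℝ → ℝ} (hf : Continuous f) {r : ℝ} (hr : DifferentiableAt ℝ f r) :
    Continuous (dd1 f r) := by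
  rw [dd1_eq_dslope, ← continuousOn_univ, continuousOn_dslope univ_mem]
  exact ⟨hf.continuousOn, hr⟩

/-- A function with derivative `f'`, where `f'` has derivative `c` at `a`, has first divided
difference `f^{[1]}(a, ·)` with derivative `c / 2` at `a`. -/
theorem hasDerivAt_dd1_self {f f' : ℝ → ℝ} {a c : ℝ} (hf : ∀ x, HasDerivAt f (f' x) x)
    (hf' : HasDerivAt f' c a) : HasDerivAt (dd1 f a) (c / 2) a := by
  have hcont : Continuous f := continuous_iff_continuousAt.2 fun x => (hf x).continuousAt
  rw [hasDerivAt_iff_tendsto_slope]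
  have key : Tendsto (fun x => (f x - f a - f' a * (x - a)) / (x - a) ^ 2) (𝓝[≠] a)
      (𝓝 (c / 2)) := by
    refine HasDerivAt.lhopital_zero_nhdsNE (f' := fun x => f' x - f' a)
      (g' := fun x => 2 * (x - a)) ?_ ?_ ?_ ?_ ?_ ?_
    · refine Eventually.of_forall fun x => ?_
      simpa using! ((hf x).sub_const (f a)).sub (((hasDerivAt_id x).sub_const a).const_mul (f' a))
    · refine Eventually.of_forall fun x => ?_
      simpa using! ((hasDerivAt_id x).sub_const a).pow 2
    · filter_upwards [self_mem_nhdsWithin] with x hx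
      exact mul_ne_zero two_ne_zero (sub_ne_zero.2 hx)
    · have : Continuous fun x => f x - f a - f' a * (x - a) := by fun_prop
      simpa using (this.tendsto a).mono_left nhdsWithin_le_nhds
    · have : Continuous fun x => (x - a) ^ 2 := by fun_prop
      simpa using (this.tendsto a).mono_left nhdsWithin_le_nhds
    · refine ((hasDerivAt_iff_tendsto_slope.1 hf').div_const 2).congr fun x => ?_
      rw [slope_def_field, div_div, mul_comm]
  refine key.congr' ?_
  filter_upwards [self_mem_nhdsWithin] with x hx
  have hxa : x - a ≠ 0 := sub_ne_zero.2 hx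
  have h1 := sub_mul_dd1 f a x
  have h2 : dd1 f a a = f' a := by rw [dd1, if_pos rfl, (hf a).deriv]
  rw [slope_def_field, h2, ← h1]
  field_simp

/-- The symmetrized second divided difference of `f` is the first divided difference of `f'`. -/
theorem dd2_add_dd2_eq_dd1 {f f' : ℝ → ℝ} {a b : ℝ} (hf : ∀ x, HasDerivAt f (f' x) x)
    (ha : DifferentiableAt ℝ f' a) :
    dd2 f a b a + dd2 f b a b = dd1 f' a b := by
  rcases eq_or_ne a b with rfl | h
  · have := (hasDerivAt_dd1_self hf ha.hasDerivAt).deriv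
    rw [dd2, if_pos rfl, dd1, if_pos rfl]
    change deriv (dd1 f a) a + deriv (dd1 f a) a = _
    rw [this, add_halves]
  · have hab : a - b ≠ 0 := sub_ne_zero.2 h
    have hba : b - a ≠ 0 := sub_ne_zero.2 h.symm
    have haa : dd1 f a a = f' a := by rw [dd1, if_pos rfl, (hf a).deriv]
    have hbb : dd1 f b b = f' b := by rw [dd1, if_pos rfl, (hf b).deriv]
    rw [dd2, if_neg h.symm, dd2, if_neg h, dd1_comm f b a, haa, hbb, dd1, dd1, if_neg h, if_neg h]
    field_simp
    ring

theorem Matrix.IsHermitian.add_real_smul {n : Type*} {A B : Matrix n n ℂ} (hA : A.IsHermitian)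
    (hB : B.IsHermitian) (t : ℝ) : (A + t • B).IsHermitian :=
  hA.add (hB.smul (IsSelfAdjoint.all t))

section Matrix

variable {n ι : Type*} [Fintype n] [DecidableEq n] [Fintype ι]

theorem Matrix.continuousOn_spectrum_real (X : Matrix n n ℂ) (g : ℝ → ℝ) :
    ContinuousOn g (spectrum ℝ X) :=
  X.finite_real_spectrum.continuousOn g

/-- If `P A = r P`, then `P (g(X) - g(r)) = P (X - A) g^{[1]}(r, X)`. -/
theorem Matrix.IsHermitian.mul_cfc_sub_smul {A X P : Matrix n n ℂ} (hX : X.IsHermitian) {r : ℝ}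
    (hP : P * A = r • P) (g : ℝ → ℝ) :
    P * cfc g X - g r • P = P * (X - A) * cfc (dd1 g r) X := by
  have hsa : IsSelfAdjoint X := hX
  have hc := X.continuousOn_spectrum_real
  have h : cfc g X = (X - r • 1) * cfc (dd1 g r) X + g r • 1 := by
    have hg : g = fun x => (x - r) * dd1 g r x + g r := by
      ext x
      rw [sub_mul_dd1, sub_add_cancel]
    conv_lhs => rw [hg]
    rw [cfc_add X _ _ (hc _) (hc _), cfc_mul _ _ X (hc _) (hc _), cfc_sub _ _ X (hc _) (hc _),
      cfc_id' ℝ X, cfc_const _ X, cfc_const _ X, Algebra.algebraMap_eq_smul_one,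
      Algebra.algebraMap_eq_smul_one]
  rw [h, mul_add, ← mul_assoc, mul_sub, mul_sub, hP]
  simp

theorem Matrix.IsHermitian.mul_cfc {A P : Matrix n n ℂ} (hA : A.IsHermitian) {r : ℝ}
    (hP : P * A = r • P) (g : ℝ → ℝ) : P * cfc g A = g r • P := by
  simpa [sub_eq_zero] using hA.mul_cfc_sub_smul hP g

theorem Matrix.IsHermitian.cfc_mul_of_isHermitian {A P : Matrix n n ℂ} (hA : A.IsHermitian)
    (hPh : P.IsHermitian) {r : ℝ} (hP : P * A = r • P) (g : ℝ → ℝ) : cfc g A * P = g r • P := by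
  have hg : (cfc g A).IsHermitian := cfc_predicate g A
  simpa [hPh.eq, hg.eq] using congrArg Matrix.conjTranspose (hA.mul_cfc hP g)

/-- If `A = ∑ i, r i • E i` for a resolution of the identity `E`, then
`g(A) = ∑ i, g (r i) • E i`. -/
theorem Matrix.IsHermitian.cfc_eq_sum {A : Matrix n n ℂ} (hA : A.IsHermitian)
    {r : ι → ℝ} {E : ι → Matrix n n ℂ} (hE : ∀ i, E i * A = r i • E i) (hsum : ∑ i, E i = 1)
    (g : ℝ → ℝ) : cfc g A = ∑ i, g (r i) • E i := by
  simp_rw [← hA.mul_cfc (hE _) g, ← Finset.sum_mul, hsum, one_mul]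

/-- A Hermitian matrix has a spectral resolution indexed by its eigenvalues with multiplicity. -/
theorem Matrix.IsHermitian.exists_resolution {A : Matrix n n ℂ} (hA : A.IsHermitian) :
    ∃ E : n → Matrix n n ℂ, (∀ i, (E i).IsHermitian) ∧
      (∀ i, E i * A = hA.eigenvalues i • E i) ∧ ∑ i, E i = 1 := by
  set U : Matrix n n ℂ := ↑hA.eigenvectorUnitary
  have hUU : star U * U = 1 := Unitary.coe_star_mul_self _
  have hUU' : U * star U = 1 := Unitary.coe_mul_star_self _
  refine ⟨fun i => U * Matrix.single i i 1 * star U, fun i => ?_, fun i => ?_, ?_⟩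
  · exact isHermitian_mul_mul_conjTranspose U (by simp [IsHermitian])
  · have h : A = U * diagonal (RCLike.ofReal ∘ hA.eigenvalues) * star U := by
      conv_lhs => rw [hA.spectral_theorem, Unitary.conjStarAlgAut_apply]
    have h' : single i i (1 : ℂ) * diagonal (RCLike.ofReal ∘ hA.eigenvalues) =
        hA.eigenvalues i • single i i (1 : ℂ) := by
      ext a b
      by_cases hb : i = b <;> simp [Matrix.mul_diagonal, Matrix.single, hb]
    calc U * single i i 1 * star U * A
        = U * single i i 1 * star U * (U * diagonal (RCLike.ofReal ∘ hA.eigenvalues) * star U) := by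
          rw [← h]
      _ = U * single i i 1 * (star U * U) * diagonal (RCLike.ofReal ∘ hA.eigenvalues) * star U := by
          simp only [mul_assoc]
      _ = U * (single i i 1 * diagonal (RCLike.ofReal ∘ hA.eigenvalues)) * star U := by
          rw [hUU, mul_one]; simp only [mul_assoc]
      _ = _ := by rw [h', mul_smul_comm, smul_mul_assoc]
  · rw [← Finset.sum_mul, ← Finset.mul_sum, sum_single_one, mul_one, hUU']

theorem Matrix.IsHermitian.trace_cfc {A : Matrix n n ℂ} (hA : A.IsHermitian) (f : ℝ → ℝ) :
    (cfc f A).trace = ∑ i, (f (hA.eigenvalues i) : ℂ) := by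
  rw [hA.cfc_eq, Matrix.IsHermitian.cfc, Unitary.conjStarAlgAut_apply, Matrix.trace_mul_cycle]
  simp [Matrix.trace]

open scoped Matrix.Norms.L2Operator in
theorem Matrix.continuous_cfc_comp {T : Type*} [TopologicalSpace T] {X : T → Matrix n n ℂ}
    (hX : Continuous X) (hX' : ∀ t, (X t).IsHermitian) {g : ℝ → ℝ} (hg : Continuous g) :
    Continuous fun t => cfc g (X t) :=
  hX.cfc_of_mem_nhdsSet (s := Set.univ) g univ_mem (fun t => hX' t) hg.continuousOn

/-- Trace form of the Daleckii–Krein formula for the derivative of `t ↦ g(A + tB)` at `0`. -/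
theorem Matrix.IsHermitian.hasDerivAt_trace_mul_cfc {A B : Matrix n n ℂ} (hA : A.IsHermitian)
    (hB : B.IsHermitian) (C : Matrix n n ℂ) {r : ι → ℝ} {E : ι → Matrix n n ℂ}
    (hE : ∀ i, E i * A = r i • E i) (hsum : ∑ i, E i = 1) {g : ℝ → ℝ} (hg : Continuous g)
    (hgr : ∀ i, E i ≠ 0 → DifferentiableAt ℝ g (r i)) :
    HasDerivAt (fun t : ℝ => (C * cfc g (A + t • B)).trace)
      (∑ i, (C * (E i * B * cfc (dd1 g (r i)) A)).trace) 0 := by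
  rw [hasDerivAt_iff_tendsto_slope_zero]
  have hlim : Tendsto (fun t : ℝ => ∑ i, (C * (E i * B * cfc (dd1 g (r i)) (A + t • B))).trace)
      (𝓝[≠] 0) (𝓝 (∑ i, (C * (E i * B * cfc (dd1 g (r i)) A)).trace)) := by
    refine tendsto_finsetSum _ fun i _ => ?_
    by_cases hi : E i = 0
    · simp [hi]
    have hc : Continuous fun t : ℝ => cfc (dd1 g (r i)) (A + t • B) :=
      Matrix.continuous_cfc_comp (by fun_prop) (hA.add_real_smul hB) (continuous_dd1 hg (hgr i hi))
    have hc' : Continuous fun t : ℝ => (C * (E i * B * cfc (dd1 g (r i)) (A + t • B))).trace :=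
      (continuous_const.matrix_mul (continuous_const.matrix_mul hc)).matrix_trace
    simpa using (hc'.tendsto 0).mono_left nhdsWithin_le_nhds
  refine hlim.congr' ?_
  filter_upwards [self_mem_nhdsWithin] with t (ht : t ≠ 0)
  have hdiff : cfc g (A + t • B) - cfc g A =
      t • ∑ i, E i * B * cfc (dd1 g (r i)) (A + t • B) := by
    have h (i) : E i * cfc g (A + t • B) - g (r i) • E i =
        t • (E i * B * cfc (dd1 g (r i)) (A + t • B)) := by
      simpa using (hA.add_real_smul hB t).mul_cfc_sub_smul (hE i) g
    rw [Finset.smul_sum, ← Finset.sum_congr rfl fun i _ => h i, Finset.sum_sub_distrib,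
      ← Finset.sum_mul, hsum, one_mul, hA.cfc_eq_sum hE hsum]
  simp only [zero_add, zero_smul, add_zero]
  rw [← Matrix.trace_sub, ← mul_sub, hdiff, mul_smul_comm, Matrix.trace_smul, smul_smul,
    inv_mul_cancel₀ ht, one_smul, Finset.mul_sum, Matrix.trace_sum]

/-- If `f` has derivative `f'`, then `t ↦ Tr f(A + tB)` has derivative
`Tr (B f'(A + tB))`. -/
theorem Matrix.IsHermitian.hasDerivAt_trace_cfc {A B : Matrix n n ℂ} (hA : A.IsHermitian)
    (hB : B.IsHermitian) {f f' : ℝ → ℝ} (hf : ∀ x, HasDerivAt f (f' x) x) (t : ℝ) :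
    HasDerivAt (fun t : ℝ => (cfc f (A + t • B)).trace) (B * cfc f' (A + t • B)).trace t := by
  have hX := hA.add_real_smul hB t
  obtain ⟨E, hEh, hE, hsum⟩ := hX.exists_resolution
  have h := hX.hasDerivAt_trace_mul_cfc hB 1 hE hsum
    (continuous_iff_continuousAt.2 fun x => (hf x).continuousAt)
    fun i _ => (hf _).differentiableAt
  have hval : ∑ i, (1 * (E i * B * cfc (dd1 f (hX.eigenvalues i)) (A + t • B))).trace =
      (B * cfc f' (A + t • B)).trace := by
    rw [hX.cfc_eq_sum hE hsum f', Finset.mul_sum, Matrix.trace_sum]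
    refine Finset.sum_congr rfl fun i _ => ?_
    rw [one_mul, mul_assoc, Matrix.trace_mul_comm, mul_assoc,
      hX.cfc_mul_of_isHermitian (hEh i) (hE i), dd1, if_pos rfl, (hf _).deriv]
  rw [hval, ← sub_self t] at h
  refine (h.comp_sub_const t t).congr_of_eventuallyEq (.of_forall fun s => ?_)
  simp only [one_mul, add_assoc, ← _root_.add_smul, add_sub_cancel]

end Matrix

/-- For `1 < p < 2`, `f_p(x) = |x|^p`, `A` invertible self-adjoint with spectral
decomposition `A = Σ_i λ_i E_i` (`λ` injective, `E_i` pairwise-orthogonal Hermitian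
projections summing to `1`) and `B` self-adjoint:
`ψ(t) := Tr(f_p(A + tB)) = Σ_i |λ_i(A + tB)|^p` is twice differentiable at `t = 0` and
`ψ''(0) = Σ_{i,j} (f_p^{[2]}(λ_i, λ_j, λ_i) + f_p^{[2]}(λ_j, λ_i, λ_j)) Tr(B E_j B E_i)`. -/
theorem trace_abs_rpow_second_deriv_eq (p : ℝ) (hp1 : 1 < p) (hp2 : p < 2)
    {k : ℕ} {A B : Matrix (Fin k) (Fin k) ℂ}
    (hA : A.IsHermitian) (hAinv : IsUnit A) (hB : B.IsHermitian)
    {ι : Type*} [Fintype ι] [DecidableEq ι] (lam : ι → ℝ) (hlam : Function.Injective lam)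
    (E : ι → Matrix (Fin k) (Fin k) ℂ) (hE : ∀ i, (E i).IsHermitian)
    (hEE : ∀ i j, E i * E j = if i = j then E i else 0)
    (hEsum : ∑ i, E i = 1) (hAE : A = ∑ i, lam i • E i) :
    (∀ᶠ t in nhds (0 : ℝ), DifferentiableAt ℝ
      (fun t : ℝ => ∑ i, |(isHermitian_add_smul hA hB t).eigenvalues i| ^ p) t) ∧
    DifferentiableAt ℝ
      (deriv fun t : ℝ => ∑ i, |(isHermitian_add_smul hA hB t).eigenvalues i| ^ p) 0 ∧
    ((deriv (deriv fun t : ℝ =>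
        ∑ i, |(isHermitian_add_smul hA hB t).eigenvalues i| ^ p) 0 : ℝ) : ℂ) =
      ∑ i, ∑ j,
        ((dd2 (fun x => |x| ^ p) (lam i) (lam j) (lam i) +
          dd2 (fun x => |x| ^ p) (lam j) (lam i) (lam j) : ℝ) : ℂ) *
            Matrix.trace (B * E j * B * E i) := by
  set f : ℝ → ℝ := fun x => |x| ^ p
  set f' : ℝ → ℝ := fun x => p * |x| ^ (p - 2) * x
  have hf (x) : HasDerivAt f (f' x) x := hasDerivAt_abs_rpow x hp1
  have hf'c : Continuous f' := by
    have h : Continuous (deriv f) := (contDiff_norm_rpow hp1).continuous_deriv le_rfl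
    rwa [funext fun x => (hf x).deriv] at h
  have hf'd (x) (hx : x ≠ 0) : DifferentiableAt ℝ f' x :=
    (((differentiableAt_abs hx).rpow_const (.inl (abs_ne_zero.2 hx))).const_mul p).mul
      differentiableAt_id
  have hEA (i) : E i * A = lam i • E i := by
    simp [hAE, Finset.mul_sum, hEE]
  have hlam0 (i) (hi : E i ≠ 0) : lam i ≠ 0 := by
    intro h0
    have h := hEA i
    rw [h0, zero_smul] at h
    exact hi (hAinv.mul_left_eq_zero.1 h)
  have hψ (t : ℝ) : HasDerivAt
      (fun t : ℝ => ∑ i, |(isHermitian_add_smul hA hB t).eigenvalues i| ^ p)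
      (B * cfc f' (A + t • B)).trace.re t := by
    refine (Complex.reCLM.hasFDerivAt.comp_hasDerivAt t
      (hA.hasDerivAt_trace_cfc hB hf t)).congr_of_eventuallyEq (.of_forall fun s => ?_)
    simp [(isHermitian_add_smul hA hB s).trace_cfc, f]
  have hψ' : HasDerivAt
      (deriv fun t : ℝ => ∑ i, |(isHermitian_add_smul hA hB t).eigenvalues i| ^ p)
      (∑ i, (B * (E i * B * cfc (dd1 f' (lam i)) A)).trace).re 0 := by
    rw [funext fun t => (hψ t).deriv]
    exact Complex.reCLM.hasFDerivAt.comp_hasDerivAt (0 : ℝ)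
      (hA.hasDerivAt_trace_mul_cfc hB B hEA hEsum hf'c fun i hi => hf'd _ (hlam0 i hi))
  refine ⟨.of_forall fun t => (hψ t).differentiableAt, hψ'.differentiableAt, ?_⟩
  have hval : ∑ i, (B * (E i * B * cfc (dd1 f' (lam i)) A)).trace =
      ∑ i, ∑ j, ((dd2 f (lam i) (lam j) (lam i) + dd2 f (lam j) (lam i) (lam j) : ℝ) : ℂ) *
        (B * E j * B * E i).trace := by
    refine Finset.sum_congr rfl fun i _ => ?_
    rw [hA.cfc_eq_sum hEA hEsum, Finset.mul_sum, Finset.mul_sum, Matrix.trace_sum]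
    refine Finset.sum_congr rfl fun j _ => ?_
    by_cases hi : E i = 0
    · simp [hi]
    rw [dd2_add_dd2_eq_dd1 hf (hf'd _ (hlam0 i hi)), mul_smul_comm, mul_smul_comm,
      Matrix.trace_smul, Complex.real_smul, ← mul_assoc, ← mul_assoc,
      mul_assoc (B * E i), Matrix.trace_mul_comm, ← mul_assoc]
  have hreal : ((∑ i, (B * (E i * B * cfc (dd1 f' (lam i)) A)).trace).re : ℂ) =
      ∑ i, (B * (E i * B * cfc (dd1 f' (lam i)) A)).trace := by
    rw [hval, ← Complex.conj_eq_iff_re, map_sum]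
    refine Finset.sum_congr rfl fun i _ => ?_
    rw [map_sum]
    refine Finset.sum_congr rfl fun j _ => ?_
    rw [map_mul, Complex.conj_ofReal, starRingEnd_apply, ← Matrix.trace_conjTranspose]
    simp only [Matrix.conjTranspose_mul, (hE _).eq, hB.eq]
    rw [Matrix.trace_mul_comm, mul_assoc]
    simp only [mul_assoc]
  rw [hψ'.deriv, hreal, hval]
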